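/- arXiv:math/0601104 — 2 statements merged into one kernel-verified Lean document; each statement's English description precedes it below -/
import Mathlib

section
/- Fix integers a, b with b > (n−1)a > 0. Let λ and μ be bipartitions of n with λ ⊴ μ in the dominance order on bipartitions and |λ^(1)| < |μ^(1)| (equivalently |λ^(2)| > |μ^(2)|). Then a_μ < a_λ, where a_λ := b·|λ^(2)| + a·(n(λ^(1)) + 2·n(λ^(2)) − n(λ^(2)*)). -/
open Finset

/-- `f : ℕ → ℕ` is the 0-indexed part function of a partition: `f i` is the part
`λ_{i+1}`; the sequence is weakly decreasing and eventually zero. -/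
def IsPartitionFun (f : ℕ → ℕ) : Prop := Antitone f ∧ ∃ M, f M = 0

/-- The size `|λ|` of the partition with part function `f`. -/
noncomputable def psize (f : ℕ → ℕ) : ℕ := ∑' i, f i

/-- `n(ν) = Σ_{i≥1} (i-1)·ν_i` for the partition with 0-indexed part function `f`. -/
noncomputable def nFn (f : ℕ → ℕ) : ℕ := ∑' i, i * f i

/-- The 0-indexed part function of the conjugate partition: `ν*_{i+1} = #{j : ν_j ≥ i+1}`. -/
noncomputable def conjFn (f : ℕ → ℕ) (i : ℕ) : ℕ := Set.ncard {j : ℕ | i + 1 ≤ f j}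

/-- The closed formula for Lusztig's `a`-invariant of the bipartition `(f | g)` when
`b > (n-1)·a > 0`:  `a_λ = b·|λ^{(2)}| + a·(n(λ^{(1)}) + 2·n(λ^{(2)}) - n(λ^{(2)*}))`. -/
noncomputable def aInv (a b : ℕ) (f g : ℕ → ℕ) : ℤ :=
  (b : ℤ) * (psize g : ℤ) +
    (a : ℤ) * ((nFn f : ℤ) + 2 * (nFn g : ℤ) - (nFn (conjFn g) : ℤ))

/-- Dominance order on bipartitions: `(f₁|g₁) ⊴ (f₂|g₂)` iff
`Σ_{i≤j} f₁_i ≤ Σ_{i≤j} f₂_i` for all `j`, and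
`|f₁| + Σ_{i≤j} g₁_i ≤ |f₂| + Σ_{i≤j} g₂_i` for all `j`. -/
def BipDominatedBy (f₁ g₁ f₂ g₂ : ℕ → ℕ) : Prop :=
  (∀ m : ℕ, ∑ i ∈ range m, f₁ i ≤ ∑ i ∈ range m, f₂ i) ∧
  (∀ m : ℕ, psize f₁ + ∑ i ∈ range m, g₁ i ≤ psize f₂ + ∑ i ∈ range m, g₂ i)

theorem psize_eq_sum_range {f : ℕ → ℕ} {M : ℕ} (h : ∀ i, M ≤ i → f i = 0) :
    psize f = ∑ i ∈ range M, f i :=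
  tsum_eq_sum fun i hi => h i (by simpa using hi)

theorem nFn_eq_sum_range {f : ℕ → ℕ} {M : ℕ} (h : ∀ i, M ≤ i → f i = 0) :
    nFn f = ∑ i ∈ range M, i * f i :=
  tsum_eq_sum fun i hi => by rw [h i (by simpa using hi), mul_zero]

theorem conjFn_eq_sum_range {f : ℕ → ℕ} {M : ℕ} (h : ∀ i, M ≤ i → f i = 0) (i : ℕ) :
    conjFn f i = ∑ j ∈ range M, if i < f j then 1 else 0 := by
  rw [← Finset.card_filter, ← Set.ncard_coe_finset]
  unfold conjFn
  congr 1
  ext j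
  simp only [Set.mem_ofPred_eq, coe_filter, mem_range]
  constructor
  · intro hj
    refine ⟨?_, hj⟩
    by_contra hM
    have := h j (by omega)
    omega
  · exact fun hj => hj.2

/-- `2·n(ν*) + |ν| = Σ ν_i²`. -/
theorem two_mul_nFn_conjFn_add_psize {f : ℕ → ℕ} {M : ℕ} (hf : Antitone f)
    (h : ∀ i, M ≤ i → f i = 0) :
    2 * nFn (conjFn f) + psize f = ∑ i ∈ range M, f i ^ 2 := by
  have hK : ∀ i, f 0 ≤ i → conjFn f i = 0 := fun i hi => by
    rw [conjFn_eq_sum_range h]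
    refine Finset.sum_eq_zero fun j _ => if_neg ?_
    have := hf (Nat.zero_le j)
    omega
  have hinner : ∀ j, ∑ i ∈ range (f 0), (if i < f j then i else 0) = ∑ i ∈ range (f j), i := by
    intro j
    rw [← Finset.sum_filter]
    congr 1
    ext i
    have := hf (Nat.zero_le j)
    simp only [mem_filter, mem_range]
    omega
  have hn : nFn (conjFn f) = ∑ j ∈ range M, ∑ i ∈ range (f j), i := by
    rw [nFn_eq_sum_range hK]
    simp only [conjFn_eq_sum_range h, Finset.mul_sum, mul_ite, mul_one, mul_zero]
    rw [Finset.sum_comm]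
    exact Finset.sum_congr rfl fun j _ => hinner j
  rw [hn, psize_eq_sum_range h, Finset.mul_sum, ← Finset.sum_add_distrib]
  refine Finset.sum_congr rfl fun j _ => ?_
  rw [mul_comm, Finset.sum_range_id_mul_two]
  cases f j with
  | zero => rfl
  | succ k => rw [Nat.add_sub_cancel]; ring

/-- Abel summation: an antitone weight preserves nonnegativity of partial sums. -/
theorem mul_sum_range_le_sum_range_mul {w x : ℕ → ℤ} (hw : Antitone w)
    (hx : ∀ m, 0 ≤ ∑ i ∈ range m, x i) (m : ℕ) :
    w m * ∑ i ∈ range m, x i ≤ ∑ i ∈ range m, w i * x i := by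
  induction m with
  | zero => simp
  | succ m ih =>
    calc w (m + 1) * ∑ i ∈ range (m + 1), x i
        ≤ w m * ∑ i ∈ range (m + 1), x i :=
          mul_le_mul_of_nonneg_right (hw m.le_succ) (hx _)
      _ ≤ ∑ i ∈ range (m + 1), w i * x i := by
          rw [Finset.sum_range_succ, Finset.sum_range_succ, mul_add]
          linarith

theorem sum_sq_le_sum_sq_of_dominated {u v : ℕ → ℕ} (hu : Antitone u) (hv : Antitone v)
    (h : ∀ m, ∑ i ∈ range m, u i ≤ ∑ i ∈ range m, v i) (M : ℕ) :
    ∑ i ∈ range M, u i ^ 2 ≤ ∑ i ∈ range M, v i ^ 2 := by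
  have hx : ∀ m, 0 ≤ ∑ i ∈ range m, ((v i : ℤ) - u i) := fun m => by
    rw [Finset.sum_sub_distrib, sub_nonneg]
    exact_mod_cast h m
  have hw : Antitone fun i => (v i : ℤ) + u i := fun i j hij => by
    have := hu hij
    have := hv hij
    dsimp only
    omega
  have key := mul_sum_range_le_sum_range_mul hw hx M
  have hpos : 0 ≤ ((v M : ℤ) + u M) * ∑ i ∈ range M, ((v i : ℤ) - u i) :=
    mul_nonneg (by positivity) (hx M)
  have hsq : ∑ i ∈ range M, ((v i : ℤ) + u i) * ((v i : ℤ) - u i)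
      = ∑ i ∈ range M, (v i : ℤ) ^ 2 - ∑ i ∈ range M, (u i : ℤ) ^ 2 := by
    rw [← Finset.sum_sub_distrib]
    exact Finset.sum_congr rfl fun i _ => by ring
  zify
  linarith

/-- If the partial sums of `u` exceed those of `v` by at most `d`, then `u` is dominated by `v`
with `d` added to its largest part. -/
theorem sum_sq_le_of_dominated_add {u v : ℕ → ℕ} (hu : Antitone u) (hv : Antitone v) (d : ℕ)
    (h : ∀ m, ∑ i ∈ range m, u i ≤ d + ∑ i ∈ range m, v i) (M : ℕ) :
    ∑ i ∈ range M, u i ^ 2 ≤ ∑ i ∈ range M, v i ^ 2 + d ^ 2 + 2 * d * v 0 := by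
  set w : ℕ → ℕ := fun i => if i = 0 then v 0 + d else v i with hw
  have hwanti : Antitone w := fun i j hij => by
    have h₁ := hv hij
    have h₂ := hv (Nat.zero_le j)
    simp only [hw]
    split_ifs <;> subst_vars <;> omega
  have hdom : ∀ m, ∑ i ∈ range m, u i ≤ ∑ i ∈ range m, w i := by
    rintro (_ | m)
    · simp
    · refine (h (m + 1)).trans (le_of_eq ?_)
      simp [Finset.sum_range_succ', hw]
      ring
  refine (sum_sq_le_sum_sq_of_dominated hu hwanti hdom M).trans ?_
  rcases M with _ | M
  · simp
  · simp only [Finset.sum_range_succ', hw, Nat.add_eq_zero_iff, one_ne_zero, and_false, if_false,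
      if_true]
    nlinarith

theorem sum_range_mul_add_sum_partial_sums (f : ℕ → ℕ) (M : ℕ) :
    ∑ i ∈ range M, i * f i + ∑ m ∈ range M, ∑ i ∈ range (m + 1), f i
      = M * ∑ i ∈ range M, f i := by
  induction M with
  | zero => simp
  | succ M ih =>
    rw [Finset.sum_range_succ (fun i => i * f i),
      Finset.sum_range_succ (fun m => ∑ i ∈ range (m + 1), f i), Finset.sum_range_succ f]
    linarith

theorem le_sum_range_or_psize_eq {f : ℕ → ℕ} (hf : Antitone f) (m : ℕ) :
    m ≤ ∑ i ∈ range m, f i ∨ psize f = ∑ i ∈ range m, f i := by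
  rcases Nat.eq_zero_or_pos (f m) with h | h
  · exact .inr (psize_eq_sum_range fun i hi => Nat.le_zero.1 (h ▸ hf hi))
  · left
    calc m = ∑ _i ∈ range m, 1 := by simp
      _ ≤ ∑ i ∈ range m, f i :=
        Finset.sum_le_sum fun i hi => h.trans_le (hf (mem_range.1 hi).le)

theorem two_mul_sum_range_min_le (d r M : ℕ) :
    2 * ∑ m ∈ range M, min d (r + d - 1 - m) + d ≤ d ^ 2 + 2 * d * r := by
  have base : ∀ d M : ℕ, 2 * ∑ m ∈ range M, (d - 1 - m) + d ≤ d ^ 2 := by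
    intro d
    induction d with
    | zero => simp
    | succ d ih =>
      rintro (_ | M)
      · simp
        nlinarith
      · have := ih M
        rw [Finset.sum_range_succ']
        have hs : ∑ m ∈ range M, (d + 1 - 1 - (m + 1)) = ∑ m ∈ range M, (d - 1 - m) :=
          Finset.sum_congr rfl fun m _ => by omega
        rw [hs]
        simp only [Nat.add_sub_cancel, Nat.sub_zero]
        nlinarith
  induction r generalizing M with
  | zero =>
    have hs : ∑ m ∈ range M, min d (0 + d - 1 - m) = ∑ m ∈ range M, (d - 1 - m) :=
      Finset.sum_congr rfl fun m _ => by omega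
    rw [hs]
    simpa using base d M
  | succ r ih =>
    rcases M with _ | M
    · simp
      nlinarith
    · have := ih M
      rw [Finset.sum_range_succ']
      have hs : ∑ m ∈ range M, min d (r + 1 + d - 1 - (m + 1))
          = ∑ m ∈ range M, min d (r + d - 1 - m) :=
        Finset.sum_congr rfl fun m _ => by omega
      rw [hs]
      have : min d (r + 1 + d - 1 - 0) ≤ d := min_le_left _ _
      nlinarith

/-- If the tails of `g₂` are at most those of `g₁`, then `n(g₂) ≤ n(g₁)`. -/
theorem nFn_le_of_dominated {g₁ g₂ : ℕ → ℕ} {M d : ℕ} (h₁ : ∀ i, M ≤ i → g₁ i = 0)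
    (h₂ : ∀ i, M ≤ i → g₂ i = 0) (hd : psize g₁ = psize g₂ + d)
    (h : ∀ m, ∑ i ∈ range m, g₁ i ≤ d + ∑ i ∈ range m, g₂ i) : nFn g₂ ≤ nFn g₁ := by
  have e₁ := sum_range_mul_add_sum_partial_sums g₁ M
  have e₂ := sum_range_mul_add_sum_partial_sums g₂ M
  rw [← nFn_eq_sum_range h₁, ← psize_eq_sum_range h₁] at e₁
  rw [← nFn_eq_sum_range h₂, ← psize_eq_sum_range h₂] at e₂
  have hs : ∑ m ∈ range M, ∑ i ∈ range (m + 1), g₁ i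
      ≤ M * d + ∑ m ∈ range M, ∑ i ∈ range (m + 1), g₂ i := by
    calc _ ≤ ∑ m ∈ range M, (d + ∑ i ∈ range (m + 1), g₂ i) :=
          Finset.sum_le_sum fun m _ => h (m + 1)
      _ = _ := by simp [Finset.sum_add_distrib]
  rw [hd] at e₁
  nlinarith

/-- If `f₁` is dominated by `f₂` and `|f₂| = |f₁| + d`, then
`n(f₂) - n(f₁) ≤ d(d-1)/2 + d·|f₁|`. -/
theorem two_mul_nFn_add_le_of_dominated {f₁ f₂ : ℕ → ℕ} {M d : ℕ} (hf₂ : Antitone f₂)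
    (h₁ : ∀ i, M ≤ i → f₁ i = 0) (h₂ : ∀ i, M ≤ i → f₂ i = 0) (hd : psize f₂ = psize f₁ + d)
    (h : ∀ m, ∑ i ∈ range m, f₁ i ≤ ∑ i ∈ range m, f₂ i) :
    2 * nFn f₂ + d ≤ 2 * nFn f₁ + d ^ 2 + 2 * d * psize f₁ := by
  have e₁ := sum_range_mul_add_sum_partial_sums f₁ M
  have e₂ := sum_range_mul_add_sum_partial_sums f₂ M
  rw [← nFn_eq_sum_range h₁, ← psize_eq_sum_range h₁] at e₁
  rw [← nFn_eq_sum_range h₂, ← psize_eq_sum_range h₂] at e₂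
  have hle : ∀ m, ∑ i ∈ range m, f₁ i ≤ psize f₁ := fun m => by
    rw [psize_eq_sum_range fun i hi => h₁ i ((le_max_left M m).trans hi)]
    exact Finset.sum_le_sum_of_subset (range_mono (le_max_right M m))
  have hs : M * d + ∑ m ∈ range M, ∑ i ∈ range (m + 1), f₁ i
      ≤ ∑ m ∈ range M, min d (psize f₁ + d - 1 - m)
        + ∑ m ∈ range M, ∑ i ∈ range (m + 1), f₂ i := by
    calc _ = ∑ m ∈ range M, (d + ∑ i ∈ range (m + 1), f₁ i) := by
          simp [Finset.sum_add_distrib]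
      _ ≤ ∑ m ∈ range M, (min d (psize f₁ + d - 1 - m) + ∑ i ∈ range (m + 1), f₂ i) := by
          refine Finset.sum_le_sum fun m _ => ?_
          have := h (m + 1)
          have := hle (m + 1)
          rcases le_sum_range_or_psize_eq hf₂ (m + 1) with h' | h' <;> omega
      _ = _ := Finset.sum_add_distrib
  have hmin := two_mul_sum_range_min_le d (psize f₁) M
  rw [hd] at e₂
  nlinarith

theorem IsPartitionFun.exists_forall_ge_eq_zero {f : ℕ → ℕ} (hf : IsPartitionFun f) :
    ∃ M, ∀ i, M ≤ i → f i = 0 :=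
  let ⟨M, hM⟩ := hf.2
  ⟨M, fun _ hi => Nat.le_zero.1 (hM ▸ hf.1 hi)⟩

theorem IsPartitionFun.apply_zero_le_psize {f : ℕ → ℕ} (hf : IsPartitionFun f) :
    f 0 ≤ psize f := by
  obtain ⟨M, hM⟩ := hf.exists_forall_ge_eq_zero
  rw [psize_eq_sum_range (M := M + 1) fun i hi => hM i (by omega)]
  exact Finset.single_le_sum (fun _ _ => Nat.zero_le _) (by simp)

/-- Fix `b > (n-1)·a > 0`.  If `λ = (f₁|g₁)` and `μ = (f₂|g₂)` are bipartitions of `n`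
with `λ ⊴ μ` in the dominance order on bipartitions and `|λ^{(1)}| < |μ^{(1)}|`
(equivalently `|λ^{(2)}| > |μ^{(2)}|`), then `a_μ < a_λ`. -/
theorem a_invariant_strict_decrease_different_sizes
    (n a b : ℕ) (hna : 0 < (n - 1) * a) (hab : (n - 1) * a < b)
    (f₁ g₁ f₂ g₂ : ℕ → ℕ)
    (hf₁ : IsPartitionFun f₁) (hg₁ : IsPartitionFun g₁)
    (hf₂ : IsPartitionFun f₂) (hg₂ : IsPartitionFun g₂)
    (hn₁ : psize f₁ + psize g₁ = n) (hn₂ : psize f₂ + psize g₂ = n)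
    (hdom : BipDominatedBy f₁ g₁ f₂ g₂)
    (hlt : psize f₁ < psize f₂) :
    aInv a b f₂ g₂ < aInv a b f₁ g₁ := by
  obtain ⟨d, hd⟩ := Nat.exists_eq_add_of_lt hlt
  obtain ⟨D, hD⟩ : ∃ D, D = d + 1 := ⟨_, rfl⟩
  have hfD : psize f₂ = psize f₁ + D := by omega
  have hgD : psize g₁ = psize g₂ + D := by omega
  have hg : ∀ m, ∑ i ∈ range m, g₁ i ≤ D + ∑ i ∈ range m, g₂ i := fun m => by
    have := hdom.2 m
    omega
  obtain ⟨M₁, hM₁⟩ := hf₁.exists_forall_ge_eq_zero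
  obtain ⟨M₂, hM₂⟩ := hf₂.exists_forall_ge_eq_zero
  obtain ⟨N₁, hN₁⟩ := hg₁.exists_forall_ge_eq_zero
  obtain ⟨N₂, hN₂⟩ := hg₂.exists_forall_ge_eq_zero
  obtain ⟨M, hM⟩ : ∃ M, M = M₁ + M₂ + N₁ + N₂ := ⟨_, rfl⟩
  have zg₁ : ∀ i, M ≤ i → g₁ i = 0 := fun i hi => hN₁ i (by omega)
  have zg₂ : ∀ i, M ≤ i → g₂ i = 0 := fun i hi => hN₂ i (by omega)
  have hnf := two_mul_nFn_add_le_of_dominated (M := M) hf₂.1 (fun i hi => hM₁ i (by omega))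
    (fun i hi => hM₂ i (by omega)) hfD hdom.1
  have hng := nFn_le_of_dominated zg₁ zg₂ hgD hg
  have hsq := sum_sq_le_of_dominated_add hg₁.1 hg₂.1 D hg M
  rw [← two_mul_nFn_conjFn_add_psize hg₁.1 zg₁, ← two_mul_nFn_conjFn_add_psize hg₂.1 zg₂] at hsq
  have hg0 : D * g₂ 0 ≤ D * psize g₂ := Nat.mul_le_mul_left _ hg₂.apply_zero_le_psize
  obtain ⟨k, rfl⟩ : ∃ k, n = k + 1 := ⟨n - 1, by
    have := Nat.pos_of_mul_pos_right hna
    omega⟩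
  rw [Nat.add_sub_cancel] at hab
  have hk : (psize f₁ : ℤ) + D + psize g₂ = k + 1 := by omega
  have hDk : (D : ℤ) * (psize f₁ + D + psize g₂) = D * (k + 1) := by rw [hk]
  have hdiff : ((nFn f₂ : ℤ) + 2 * nFn g₂ - nFn (conjFn g₂))
      - (nFn f₁ + 2 * nFn g₁ - nFn (conjFn g₁)) ≤ k * D := by
    zify at hnf hng hsq hg0 hgD
    linarith
  have hmul := mul_le_mul_of_nonneg_left hdiff (Int.natCast_nonneg a)
  have hb : ((k : ℤ) * a) * D < b * D := by
    have hpos : (0 : ℤ) < D := by omega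
    exact mul_lt_mul_of_pos_right (by exact_mod_cast hab) hpos
  unfold aInv
  rw [hgD]
  push_cast
  linarith
end

section
/- Fix integers a > 0 and b ≥ 0. Let λ be a bipartition of n, and let μ and ν be bipartitions of n+1 with [μ] = [λ] ∪ {γ₁} and [ν] = [λ] ∪ {γ₂}, where γ₁ = (a₁, b₁, c₁) and γ₂ = (a₂, b₂, c₂) are addable nodes of λ. If a·(λ^{(c₁)}_{a₁} − a₁) + b·[c₁ = 1] > a·(λ^{(c₂)}_{a₂} − a₂) + b·[c₂ = 1] (where [c = 1] equals 1 if c = 1 and 0 otherwise), then a_ν > a_μ. -/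
open Finset

/-- `α_i = a·(λ^{(1)}_{N+r-i+1} + i - 1) + b'` for `1 ≤ i ≤ N + r`,
where `f` is the 0-indexed part function of `λ^{(1)}`. -/
def alphaE (a b' r N : ℕ) (f : ℕ → ℕ) (i : ℕ) : ℕ := a * (f (N + r - i) + (i - 1)) + b'

/-- `β_j = a·(λ^{(2)}_{N-j+1} + j - 1)` for `1 ≤ j ≤ N`,
where `g` is the 0-indexed part function of `λ^{(2)}`. -/
def betaE (a N : ℕ) (g : ℕ → ℕ) (j : ℕ) : ℕ := a * (g (N - j) + (j - 1))

/-- `A_N(λ) = Σ_{1≤i≤N+r, 1≤j≤N} min(α_i, β_j) + Σ_{1≤i<j≤N+r} min(α_i, α_j)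
    + Σ_{1≤i<j≤N} min(β_i, β_j)`. -/
def AE (a b' r N : ℕ) (f g : ℕ → ℕ) : ℕ :=
  (∑ i ∈ Icc 1 (N + r), ∑ j ∈ Icc 1 N, min (alphaE a b' r N f i) (betaE a N g j)) +
  (∑ i ∈ Icc 1 (N + r), ∑ j ∈ Icc (i + 1) (N + r),
      min (alphaE a b' r N f i) (alphaE a b' r N f j)) +
  (∑ i ∈ Icc 1 N, ∑ j ∈ Icc (i + 1) N, min (betaE a N g i) (betaE a N g j))

/-- `B_N = Σ_{1≤i≤N+r, 1≤j≤N} min(a(i-1)+b', a(j-1))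
    + Σ_{1≤i<j≤N+r} min(a(i-1)+b', a(j-1)+b') + Σ_{1≤i<j≤N} min(a(i-1), a(j-1))`. -/
def BE (a b' r N : ℕ) : ℕ :=
  (∑ i ∈ Icc 1 (N + r), ∑ j ∈ Icc 1 N, min (a * (i - 1) + b') (a * (j - 1))) +
  (∑ i ∈ Icc 1 (N + r), ∑ j ∈ Icc (i + 1) (N + r),
      min (a * (i - 1) + b') (a * (j - 1) + b')) +
  (∑ i ∈ Icc 1 N, ∑ j ∈ Icc (i + 1) N, min (a * (i - 1)) (a * (j - 1)))

/-- `N` is admissible for the bipartition `(f | g)`: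
`λ^{(1)}_{N+r+1} = 0` and `λ^{(2)}_{N+1} = 0`. -/
def AdmissibleN (r N : ℕ) (f g : ℕ → ℕ) : Prop := f (N + r) = 0 ∧ g N = 0

/-- The part function of a partition vanishes from any zero onwards. -/
lemma IsPartitionFun.eq_zero_of_le {f : ℕ → ℕ} (hf : IsPartitionFun f) {m k : ℕ}
    (hm : f m = 0) (hk : m ≤ k) : f k = 0 :=
  Nat.le_zero.1 (hm ▸ hf.1 hk)

lemma AdmissibleN.mono {r N M : ℕ} {f g : ℕ → ℕ} (hf : IsPartitionFun f)
    (hg : IsPartitionFun g) (h : AdmissibleN r N f g) (hNM : N ≤ M) : AdmissibleN r M f g :=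
  ⟨hf.eq_zero_of_le h.1 (by omega), hg.eq_zero_of_le h.2 hNM⟩

lemma sum_Icc_succ_succ {M : Type*} [AddCommMonoid M] (k m : ℕ) (φ : ℕ → M) :
    ∑ i ∈ Icc (k + 1) (m + 1), φ i = ∑ i ∈ Icc k m, φ (i + 1) := by
  rw [← Finset.map_add_right_Icc, Finset.sum_map]
  rfl

lemma sum_Icc_one_succ {M : Type*} [AddCommMonoid M] (m : ℕ) (φ : ℕ → M) :
    ∑ i ∈ Icc 1 (m + 1), φ i = φ 1 + ∑ i ∈ Icc 1 m, φ (i + 1) := by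
  rw [← Finset.add_sum_Ioc_eq_sum_Icc (by omega), ← sum_Icc_succ_succ]
  rfl

/-- The increment of `AE` when passing from `N` to `N + 1`. -/
def AEStep (a b' r N : ℕ) : ℕ :=
  (∑ _j ∈ Icc 1 N, b' + ∑ _i ∈ Icc 1 (N + r), ∑ _j ∈ Icc 1 N, a) +
  (∑ _j ∈ Icc 1 (N + r), b' + ∑ i ∈ Icc 1 (N + r), ∑ _j ∈ Icc (i + 1) (N + r), a) +
  ∑ i ∈ Icc 1 N, ∑ _j ∈ Icc (i + 1) N, a

lemma AE_succ {a b' r N : ℕ} {f g : ℕ → ℕ} (hb' : b' < a) (h : AdmissibleN r N f g) :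
    AE a b' r (N + 1) f g = AE a b' r N f g + AEStep a b' r N := by
  have hα₁ : alphaE a b' r (N + 1) f 1 = b' := by
    simp [alphaE, show N + 1 + r - 1 = N + r by omega, h.1]
  have hβ₁ : betaE a (N + 1) g 1 = 0 := by
    simp [betaE, h.2]
  have hα : ∀ i ∈ Icc 1 (N + r),
      alphaE a b' r (N + 1) f (i + 1) = alphaE a b' r N f i + a := by
    intro i hi
    obtain ⟨k, rfl⟩ : ∃ k, i = k + 1 := ⟨i - 1, by have := (mem_Icc.1 hi).1; omega⟩
    simp only [alphaE, show N + 1 + r - (k + 1 + 1) = N + r - (k + 1) by omega,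
      Nat.add_sub_cancel]
    ring
  have hβ : ∀ j ∈ Icc 1 N, betaE a (N + 1) g (j + 1) = betaE a N g j + a := by
    intro i hi
    obtain ⟨k, rfl⟩ : ∃ k, i = k + 1 := ⟨i - 1, by have := (mem_Icc.1 hi).1; omega⟩
    simp only [betaE, show N + 1 - (k + 1 + 1) = N - (k + 1) by omega, Nat.add_sub_cancel]
    ring
  have hsub : ∀ {m i j : ℕ}, j ∈ Icc (i + 1) m → j ∈ Icc 1 m := by
    intro m i j hj
    rw [mem_Icc] at hj ⊢
    omega
  have h₁ : ∑ i ∈ Icc 1 (N + r + 1), ∑ j ∈ Icc 1 (N + 1),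
        min (alphaE a b' r (N + 1) f i) (betaE a (N + 1) g j) =
      ∑ i ∈ Icc 1 (N + r), ∑ j ∈ Icc 1 N, min (alphaE a b' r N f i) (betaE a N g j) +
        (∑ _j ∈ Icc 1 N, b' + ∑ _i ∈ Icc 1 (N + r), ∑ _j ∈ Icc 1 N, a) := by
    simp only [sum_Icc_one_succ, hα₁, hβ₁, Nat.min_zero, zero_add]
    conv_rhs => rw [add_left_comm, ← sum_add_distrib]
    congr 1
    · refine sum_congr rfl fun j hj => ?_
      rw [hβ j hj]
      omega
    · refine sum_congr rfl fun i hi => ?_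
      rw [← sum_add_distrib]
      refine sum_congr rfl fun j hj => ?_
      rw [hα i hi, hβ j hj]
      omega
  have h₂ : ∑ i ∈ Icc 1 (N + r + 1), ∑ j ∈ Icc (i + 1) (N + r + 1),
        min (alphaE a b' r (N + 1) f i) (alphaE a b' r (N + 1) f j) =
      ∑ i ∈ Icc 1 (N + r), ∑ j ∈ Icc (i + 1) (N + r),
          min (alphaE a b' r N f i) (alphaE a b' r N f j) +
        (∑ _j ∈ Icc 1 (N + r), b' +
          ∑ i ∈ Icc 1 (N + r), ∑ _j ∈ Icc (i + 1) (N + r), a) := by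
    simp only [sum_Icc_one_succ]
    simp only [sum_Icc_succ_succ, hα₁]
    conv_rhs => rw [add_left_comm, ← sum_add_distrib]
    congr 1
    · refine sum_congr rfl fun j hj => ?_
      rw [hα j hj]
      omega
    · refine sum_congr rfl fun i hi => ?_
      rw [← sum_add_distrib]
      refine sum_congr rfl fun j hj => ?_
      rw [hα i hi, hα j (hsub hj)]
      omega
  have h₃ : ∑ i ∈ Icc 1 (N + 1), ∑ j ∈ Icc (i + 1) (N + 1),
        min (betaE a (N + 1) g i) (betaE a (N + 1) g j) =
      ∑ i ∈ Icc 1 N, ∑ j ∈ Icc (i + 1) N, min (betaE a N g i) (betaE a N g j) +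
        ∑ i ∈ Icc 1 N, ∑ _j ∈ Icc (i + 1) N, a := by
    simp only [sum_Icc_one_succ]
    simp only [sum_Icc_succ_succ, hβ₁, Nat.zero_min, sum_const_zero, zero_add]
    rw [← sum_add_distrib]
    refine sum_congr rfl fun i hi => ?_
    rw [← sum_add_distrib]
    refine sum_congr rfl fun j hj => ?_
    rw [hβ i hi, hβ j (hsub hj)]
    omega
  unfold AE
  rw [show N + 1 + r = N + r + 1 by omega, h₁, h₂, h₃, AEStep]
  omega

lemma BE_eq_AE (a b' r N : ℕ) : BE a b' r N = AE a b' r N 0 0 := by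
  simp [BE, AE, alphaE, betaE]

lemma AE_sub_BE_eq_of_le {a b' r N M : ℕ} {f g : ℕ → ℕ} (hb' : b' < a)
    (hf : IsPartitionFun f) (hg : IsPartitionFun g) (h : AdmissibleN r N f g) (hNM : N ≤ M) :
    (AE a b' r M f g : ℤ) - BE a b' r M = (AE a b' r N f g : ℤ) - BE a b' r N := by
  induction M, hNM using Nat.le_induction with
  | base => rfl
  | succ M hM ih =>
    rw [← ih, BE_eq_AE, BE_eq_AE, AE_succ hb' (h.mono hf hg hM), AE_succ hb' ⟨rfl, rfl⟩]
    push_cast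
    ring

lemma two_mul_sum_Icc_lt (m : ℕ) (u : ℕ → ℤ) :
    2 * ∑ i ∈ Icc 1 m, ∑ j ∈ Icc (i + 1) m, min (u i) (u j) =
      ∑ i ∈ Icc 1 m, ∑ j ∈ Icc 1 m, min (u i) (u j) - ∑ i ∈ Icc 1 m, u i := by
  induction m with
  | zero => simp
  | succ m ih =>
    have h : ∀ i ∈ Icc 1 m, ∑ j ∈ Icc (i + 1) (m + 1), min (u i) (u j) =
        ∑ j ∈ Icc (i + 1) m, min (u i) (u j) + min (u (m + 1)) (u i) := by
      intro i hi
      rw [sum_Icc_succ_top (by have := (mem_Icc.1 hi).2; omega), min_comm (u (m + 1))]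
    simp only [sum_Icc_succ_top (show 1 ≤ m + 1 by omega)]
    have h' : ∑ i ∈ Icc 1 m, min (u i) (u (m + 1)) = ∑ i ∈ Icc 1 m, min (u (m + 1)) (u i) :=
      sum_congr rfl fun i _ => min_comm _ _
    rw [sum_congr rfl h]
    simp only [sum_add_distrib, min_self, h']
    rw [Icc_eq_empty (show ¬ m + 1 + 1 ≤ m + 1 by omega), sum_empty]
    linarith

/-- Twice the sum of `min (z x) (z y)` over unordered pairs of distinct elements of `s`. -/
def minPairs {ι : Type*} (s : Finset ι) (z : ι → ℤ) : ℤ :=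
  ∑ x ∈ s, ∑ y ∈ s, min (z x) (z y) - ∑ x ∈ s, z x

lemma minPairs_bump {ι : Type*} [DecidableEq ι] {s : Finset ι} {z w : ι → ℤ} {p : ι} {a : ℤ}
    (ha : 0 ≤ a) (hp : p ∈ s) (hwp : w p = z p + a) (hw : ∀ x ∈ s, x ≠ p → w x = z x) :
    minPairs s w =
      minPairs s z + 2 * ∑ y ∈ s, (min (z p + a) (z y) - min (z p) (z y)) := by
  set h : ι → ℤ := fun y => min (z p + a) (z y) - min (z p) (z y) with hh
  have hone : ∀ x ∈ s, w x = z x + if x = p then a else 0 := by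
    intro x hx
    split_ifs with hxp
    · rw [hxp, hwp]
    · rw [hw x hx hxp, add_zero]
  have hpair : ∀ x ∈ s, ∀ y ∈ s, min (w x) (w y) =
      min (z x) (z y) + (if x = p then h y else 0) + (if y = p then h x else 0) +
        if x = p then if y = p then a else 0 else 0 := by
    intro x hx y hy
    simp only [hone x hx, hone y hy, hh]
    split_ifs <;> subst_vars <;> omega
  have hsum : ∑ x ∈ s, ∑ y ∈ s, min (w x) (w y) =
      ∑ x ∈ s, ∑ y ∈ s, min (z x) (z y) + 2 * ∑ y ∈ s, h y + a := by
    rw [sum_congr rfl fun x hx => sum_congr rfl (hpair x hx)]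
    simp only [sum_add_distrib]
    rw [sum_comm (f := fun x y => if x = p then h y else 0)]
    simp only [sum_ite_eq', hp, if_true]
    have : ∑ x ∈ s, ∑ y ∈ s, (if x = p then if y = p then a else 0 else 0) = a := by
      rw [sum_comm]
      simp [hp]
    rw [this]
    ring
  have hsum' : ∑ x ∈ s, w x = ∑ x ∈ s, z x + a := by
    rw [sum_congr rfl hone, sum_add_distrib, sum_ite_eq', if_pos hp]
  rw [minPairs, minPairs, hsum, hsum']
  ring

/-- Raising a larger entry by `a` gives a smaller sum of pairwise minima than raising a smaller
entry by `a`. -/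
lemma minPairs_lt_of_bump {ι : Type*} [DecidableEq ι] {s : Finset ι} {z u v : ι → ℤ} {p q : ι}
    {a : ℤ} (ha : 0 < a) (hp : p ∈ s) (hq : q ∈ s)
    (hup : u p = z p + a) (hu : ∀ x ∈ s, x ≠ p → u x = z x)
    (hvq : v q = z q + a) (hv : ∀ x ∈ s, x ≠ q → v x = z x) (hlt : z q < z p) :
    minPairs s u < minPairs s v := by
  rw [minPairs_bump ha.le hp hup hu, minPairs_bump ha.le hq hvq hv]
  have h : ∑ y ∈ s, (min (z p + a) (z y) - min (z p) (z y)) <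
      ∑ y ∈ s, (min (z q + a) (z y) - min (z q) (z y)) :=
    sum_lt_sum (fun y _ => by omega) ⟨p, hp, by omega⟩
  omega

/-- The numbers `α_i` and `β_j` as a single family. -/
def entries (a b' r N : ℕ) (f g : ℕ → ℕ) : ℕ ⊕ ℕ → ℤ :=
  Sum.elim (fun i => (alphaE a b' r N f i : ℤ)) (fun j => (betaE a N g j : ℤ))

lemma two_mul_AE (a b' r N : ℕ) (f g : ℕ → ℕ) :
    2 * (AE a b' r N f g : ℤ) =
      minPairs ((Icc 1 (N + r)).disjSum (Icc 1 N)) (entries a b' r N f g) := by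
  have h₁ := two_mul_sum_Icc_lt (N + r) fun i => (alphaE a b' r N f i : ℤ)
  have h₂ := two_mul_sum_Icc_lt N fun j => (betaE a N g j : ℤ)
  have h₃ : ∑ j ∈ Icc 1 N, ∑ i ∈ Icc 1 (N + r),
      min (betaE a N g j : ℤ) (alphaE a b' r N f i : ℤ) =
      ∑ i ∈ Icc 1 (N + r), ∑ j ∈ Icc 1 N,
        min (alphaE a b' r N f i : ℤ) (betaE a N g j : ℤ) := by
    rw [sum_comm]
    simp only [min_comm]
  simp only [minPairs, sum_disjSum, entries, Sum.elim_inl, Sum.elim_inr, sum_add_distrib, AE]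
  push_cast
  linarith

/-- The index in the family `entries` of the row `i` (counted from `0`) of the component `c`. -/
def rowIndex (r N : ℕ) (c : Fin 2) (i : ℕ) : ℕ ⊕ ℕ :=
  if c = 0 then Sum.inl (N + r - i) else Sum.inr (N - i)

lemma exists_row_of_mem {r N : ℕ} {x : ℕ ⊕ ℕ}
    (hx : x ∈ (Icc 1 (N + r)).disjSum (Icc 1 N)) :
    ∃ (c : Fin 2) (i : ℕ), i < (if c = 0 then N + r else N) ∧ x = rowIndex r N c i := by
  rcases x with x | x
  · have := mem_Icc.1 (inl_mem_disjSum.1 hx)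
    exact ⟨0, N + r - x, by simp; omega, by simp [rowIndex]; omega⟩
  · have := mem_Icc.1 (inr_mem_disjSum.1 hx)
    exact ⟨1, N - x, by simp; omega, by simp [rowIndex]; omega⟩

lemma rowIndex_mem {r N i : ℕ} {c : Fin 2} (hi : i < if c = 0 then N + r else N) :
    rowIndex r N c i ∈ (Icc 1 (N + r)).disjSum (Icc 1 N) := by
  by_cases hc : c = 0 <;> simp only [hc, if_true, if_false] at hi <;>
    simp [rowIndex, hc] <;> omega

lemma entries_rowIndex {a b r b' N i : ℕ} {c : Fin 2} (hb : b = a * r + b')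
    (lam : Fin 2 → ℕ → ℕ) (hi : i < if c = 0 then N + r else N) :
    entries a b' r N (lam 0) (lam 1) (rowIndex r N c i) =
      (a : ℤ) * ((lam c i : ℤ) - ((i : ℤ) + 1)) + (b : ℤ) * (if c = 0 then 1 else 0) +
        a * N := by
  match c with
  | 0 =>
    simp only [if_true] at hi
    obtain ⟨k, hk⟩ : ∃ k, N + r = i + 1 + k := ⟨N + r - (i + 1), by omega⟩
    have hk' : (N : ℤ) + r = i + 1 + k := by exact_mod_cast hk
    simp only [entries, rowIndex, if_true, Sum.elim_inl, alphaE, hb,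
      show N + r - (N + r - i) = i by omega, show N + r - i - 1 = k by omega]
    push_cast
    linear_combination -(a : ℤ) * hk'
  | 1 =>
    simp only [Fin.isValue, one_ne_zero, if_false] at hi
    obtain ⟨k, hk⟩ : ∃ k, N = i + 1 + k := ⟨N - (i + 1), by omega⟩
    have hk' : (N : ℤ) = i + 1 + k := by exact_mod_cast hk
    simp only [entries, rowIndex, Fin.isValue, one_ne_zero, if_false, Sum.elim_inr, betaE,
      show N - (N - i) = i by omega, show N - i - 1 = k by omega]
    push_cast
    linear_combination -(a : ℤ) * hk'

lemma lt_of_admissibleN {r N i : ℕ} {c : Fin 2} {mu : Fin 2 → ℕ → ℕ}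
    (hmu : ∀ c, IsPartitionFun (mu c)) (h : AdmissibleN r N (mu 0) (mu 1))
    (hi : mu c i ≠ 0) : i < if c = 0 then N + r else N := by
  by_contra! hle
  refine hi ((hmu c).eq_zero_of_le ?_ hle)
  match c with
  | 0 => simpa using h.1
  | 1 => simpa using h.2

/-- Adding a node to a row raises the corresponding entry by `a` and fixes the others. -/
lemma entries_add_node {a r b' N i₁ : ℕ} {c₁ : Fin 2} {lam mu : Fin 2 → ℕ → ℕ}
    (hi₁ : i₁ < if c₁ = 0 then N + r else N) (hmu₁ : mu c₁ i₁ = lam c₁ i₁ + 1)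
    (hmu₂ : ∀ (c : Fin 2) (i : ℕ), ¬(c = c₁ ∧ i = i₁) → mu c i = lam c i) :
    entries a b' r N (mu 0) (mu 1) (rowIndex r N c₁ i₁) =
        entries a b' r N (lam 0) (lam 1) (rowIndex r N c₁ i₁) + a ∧
      ∀ x ∈ (Icc 1 (N + r)).disjSum (Icc 1 N), x ≠ rowIndex r N c₁ i₁ →
        entries a b' r N (mu 0) (mu 1) x = entries a b' r N (lam 0) (lam 1) x := by
  constructor
  · rw [entries_rowIndex rfl mu hi₁, entries_rowIndex rfl lam hi₁, hmu₁]
    push_cast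
    ring
  · intro x hx hne
    obtain ⟨c, i, hi, rfl⟩ := exists_row_of_mem hx
    rw [entries_rowIndex rfl mu hi, entries_rowIndex rfl lam hi, hmu₂ c i]
    rintro ⟨rfl, rfl⟩
    exact hne rfl

/-- Let `λ` be a bipartition of `n` (components indexed by `Fin 2`, with `0`
corresponding to the first component), and let `μ, ν` be bipartitions of `n+1` obtained
from `λ` by adding one node: `μ` adds a node in row `i₁` (0-indexed) of component `c₁`
and `ν` adds a node in row `i₂` of component `c₂`.  If
`a·(λ^{(c₁)}_{i₁+1} - (i₁+1)) + b·[c₁ = 1] > a·(λ^{(c₂)}_{i₂+1} - (i₂+1)) + b·[c₂ = 1]`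
(comparison of shifted contents `λ^{(c)}_a - a + m^{(c)}` with `m^{(1)} = b/a`,
`m^{(2)} = 0`, cleared of denominators), then `a_ν > a_μ`. -/
theorem a_invariant_addable_node_comparison
    (n a b r b' : ℕ) (ha : 0 < a) (hb : b = a * r + b') (hb' : b' < a)
    (lam mu nu : Fin 2 → ℕ → ℕ)
    (hlam : ∀ c, IsPartitionFun (lam c))
    (hmu : ∀ c, IsPartitionFun (mu c)) (hnu : ∀ c, IsPartitionFun (nu c))
    (hn : psize (lam 0) + psize (lam 1) = n)
    (c₁ c₂ : Fin 2) (i₁ i₂ : ℕ)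
    (hmu₁ : mu c₁ i₁ = lam c₁ i₁ + 1)
    (hmu₂ : ∀ (c : Fin 2) (i : ℕ), ¬(c = c₁ ∧ i = i₁) → mu c i = lam c i)
    (hnu₁ : nu c₂ i₂ = lam c₂ i₂ + 1)
    (hnu₂ : ∀ (c : Fin 2) (i : ℕ), ¬(c = c₂ ∧ i = i₂) → nu c i = lam c i)
    (hcmp : (a : ℤ) * ((lam c₂ i₂ : ℤ) - ((i₂ : ℤ) + 1))
              + (b : ℤ) * (if c₂ = 0 then 1 else 0)
          < (a : ℤ) * ((lam c₁ i₁ : ℤ) - ((i₁ : ℤ) + 1))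
              + (b : ℤ) * (if c₁ = 0 then 1 else 0)) :
    ∀ N N' : ℕ, AdmissibleN r N (mu 0) (mu 1) → AdmissibleN r N' (nu 0) (nu 1) →
      (AE a b' r N (mu 0) (mu 1) : ℤ) - (BE a b' r N : ℤ) <
        (AE a b' r N' (nu 0) (nu 1) : ℤ) - (BE a b' r N' : ℤ) := by
  intro N N' hN hN'
  have hM := hN.mono (hmu 0) (hmu 1) (le_max_left N N')
  have hM' := hN'.mono (hnu 0) (hnu 1) (le_max_right N N')
  rw [← AE_sub_BE_eq_of_le hb' (hmu 0) (hmu 1) hN (le_max_left N N'),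
    ← AE_sub_BE_eq_of_le hb' (hnu 0) (hnu 1) hN' (le_max_right N N')]
  generalize max N N' = M at hM hM'
  have hi₁ := lt_of_admissibleN hmu hM (c := c₁) (i := i₁) (by omega)
  have hi₂ := lt_of_admissibleN hnu hM' (c := c₂) (i := i₂) (by omega)
  obtain ⟨hu, hu'⟩ := entries_add_node (a := a) (b' := b') hi₁ hmu₁ hmu₂
  obtain ⟨hv, hv'⟩ := entries_add_node (a := a) (b' := b') hi₂ hnu₁ hnu₂
  have hlt := minPairs_lt_of_bump (by exact_mod_cast ha) (rowIndex_mem hi₁) (rowIndex_mem hi₂)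
    hu hu' hv hv' (by
      rw [entries_rowIndex hb lam hi₁, entries_rowIndex hb lam hi₂]
      linarith)
  rw [← two_mul_AE, ← two_mul_AE] at hlt
  linarith
end
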